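/- For every u ∈ K⟨υ^{±1/p^∞}⟩ whose constant coefficient strictly dominates all other coefficients (i.e., |u(q)| < |u(0)| for all q ≠ 0), every integer n ∈ ℤ, and every b ∈ ℕ, the element υ^{n/p^b}·u (the shift of u whose coefficient at q is u(q − n/p^b)) is a unit of the ring K⟨υ^{±1/p^∞}⟩. -/

import Mathlib

open Filter

variable {K : Type*} [NontriviallyNormedField K] [IsUltrametricDist K] [CompleteSpace K]

/-- The exponent set `D = ℤ[1/p]_{≥0} = {a/p^b : a, b ∈ ℕ}`. -/
def Dset (p : ℕ) : Set ℚ := {q | ∃ a b : ℕ, q = (a : ℚ) / (p : ℚ) ^ b}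

/-- The exponent set `−D = {−a/p^b : a, b ∈ ℕ}`. -/
def negDset (p : ℕ) : Set ℚ := {q | ∃ a b : ℕ, q = -((a : ℚ) / (p : ℚ) ^ b)}

/-- The exponent set `ℤ[1/p] = {a/p^b : a ∈ ℤ, b ∈ ℕ}`. -/
def Zpset (p : ℕ) : Set ℚ := {q | ∃ (a : ℤ) (b : ℕ), q = (a : ℚ) / (p : ℚ) ^ b}

/-- Membership in the algebra of series supported on `S` with coefficients tending to `0`. -/
def MemAlg (S : Set ℚ) (f : ℚ → K) : Prop :=
  (∀ q, q ∉ S → f q = 0) ∧ Filter.Tendsto f Filter.cofinite (nhds 0)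

/-- The Gauss norm `‖f‖ = sup_q |f q|`. -/
noncomputable def gaussNorm (f : ℚ → K) : ℝ := ⨆ q : ℚ, ‖f q‖

/-- Convolution product of series. -/
noncomputable def conv (f g : ℚ → K) : ℚ → K := fun q => ∑' r : ℚ, f r * g (q - r)

/-- The multiplicative unit: the series `1`. -/
def oneF : ℚ → K := fun q => if q = 0 then 1 else 0

/-- `υ^d`: the series supported at the single exponent `d` with coefficient `1`. -/
def upsilon (d : ℚ) : ℚ → K := fun q => if q = d then 1 else 0

/-- `f` is a unit of the algebra of series supported on `S`. -/
def IsUnitIn (S : Set ℚ) (f : ℚ → K) : Prop :=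
  MemAlg S f ∧ ∃ g : ℚ → K, MemAlg S g ∧ conv f g = oneF ∧ conv g f = oneF

open scoped ZeroAtInfty in
theorem aux_fixed {X : Type*} [TopologicalSpace X] [DiscreteTopology X]
    (Φ : (X → K) → (X → K))
    (hΦ : ∀ f, Tendsto f cofinite (nhds 0) → Tendsto (Φ f) cofinite (nhds 0))
    (c : ℝ) (hc0 : 0 ≤ c) (hc : c < 1)
    (hcon : ∀ f g, Tendsto f cofinite (nhds 0) → Tendsto g cofinite (nhds 0) →
      ∀ C : ℝ, 0 ≤ C → (∀ q, ‖f q - g q‖ ≤ C) → ∀ q, ‖Φ f q - Φ g q‖ ≤ c * C) :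
    ∃ g, Tendsto g cofinite (nhds 0) ∧ Φ g = g := by
  have ht : ∀ f : C₀(X, K), Tendsto (f : X → K) cofinite (nhds 0) := by
    intro f
    have := f.zero_at_infty'
    rwa [cocompact_eq_cofinite] at this
  let Ψ : C₀(X, K) → C₀(X, K) := fun f =>
    ⟨⟨Φ f, continuous_of_discreteTopology⟩, by
      rw [cocompact_eq_cofinite]; exact hΦ _ (ht f)⟩
  have hΨ : ContractingWith ⟨c, hc0⟩ Ψ := by
    refine ⟨by exact_mod_cast hc, LipschitzWith.of_dist_le_mul fun f g => ?_⟩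
    rw [← ZeroAtInftyContinuousMap.dist_toBCF_eq_dist]
    refine (BoundedContinuousFunction.dist_le (by positivity)).2 fun x => ?_
    rw [dist_eq_norm]
    refine hcon f g (ht f) (ht g) (dist f g) dist_nonneg (fun q => ?_) x
    rw [← dist_eq_norm, ← ZeroAtInftyContinuousMap.dist_toBCF_eq_dist]
    exact BoundedContinuousFunction.dist_coe_le_dist (f := f.toBCF) (g := g.toBCF) q
  refine ⟨(ContractingWith.fixedPoint Ψ hΨ : C₀(X, K)), ht (ContractingWith.fixedPoint Ψ hΨ), ?_⟩
  exact congrArg (fun f : C₀(X, K) => (f : X → K)) hΨ.fixedPoint_isFixedPt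

theorem aux_bdd {f : ℚ → K} (hf : Tendsto f cofinite (nhds 0)) :
    ∃ B : ℝ, 0 < B ∧ ∀ q, ‖f q‖ ≤ B := by
  have h1 := (Metric.tendsto_nhds.1 hf) 1 one_pos
  rw [eventually_cofinite] at h1
  obtain ⟨M, hM⟩ := (h1.image (fun q => ‖f q‖)).bddAbove
  refine ⟨max M 1, by positivity, fun q => ?_⟩
  by_cases hq : dist (f q) 0 < 1
  · rw [dist_zero_right] at hq
    exact hq.le.trans (le_max_right _ _)
  · exact (hM ⟨q, hq, rfl⟩).trans (le_max_left _ _)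

theorem aux_summable {f g : ℚ → K} (hf : Tendsto f cofinite (nhds 0))
    (hg : Tendsto g cofinite (nhds 0)) (q : ℚ) : Summable (fun r => f r * g (q - r)) := by
  apply NonarchimedeanAddGroup.summable_of_tendsto_cofinite_zero
  have h : Tendsto (fun r => g (q - r)) cofinite (nhds 0) :=
    hg.comp (sub_right_injective).tendsto_cofinite
  simpa using hf.mul h

theorem aux_tsum_le {f : ℚ → K} {C : ℝ} (hC : 0 ≤ C) (h : ∀ q, ‖f q‖ ≤ C) :
    ‖∑' q, f q‖ ≤ C :=
  (IsUltrametricDist.norm_tsum_le f).trans (Real.iSup_le h hC)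

theorem aux_conv_tendsto {f g : ℚ → K} (hf : Tendsto f cofinite (nhds 0))
    (hg : Tendsto g cofinite (nhds 0)) : Tendsto (conv f g) cofinite (nhds 0) := by
  obtain ⟨A, hA, hfA⟩ := aux_bdd hf
  obtain ⟨B, hB, hgB⟩ := aux_bdd hg
  rw [Metric.tendsto_nhds]
  intro ε hε
  have h1 := (Metric.tendsto_nhds.1 hf) (ε / 2 / B) (by positivity)
  have h2 := (Metric.tendsto_nhds.1 hg) (ε / 2 / A) (by positivity)
  rw [eventually_cofinite] at h1 h2 ⊢
  refine (Set.Finite.image2 (fun a b => a + b) h1 h2).subset fun q hq => ?_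
  by_contra hn
  apply hq
  rw [dist_zero_right]
  refine lt_of_le_of_lt (aux_tsum_le (C := ε / 2) (by positivity) fun r => ?_) (by linarith)
  rw [norm_mul]
  by_cases hr : dist (f r) 0 < ε / 2 / B
  · rw [dist_zero_right] at hr
    calc ‖f r‖ * ‖g (q - r)‖ ≤ ε / 2 / B * B :=
          mul_le_mul hr.le (hgB _) (norm_nonneg _) (by positivity)
      _ = ε / 2 := by field_simp
  · by_cases hs : dist (g (q - r)) 0 < ε / 2 / A
    · rw [dist_zero_right] at hs
      calc ‖f r‖ * ‖g (q - r)‖ ≤ A * (ε / 2 / A) :=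
            mul_le_mul (hfA _) hs.le (norm_nonneg _) hA.le
        _ = ε / 2 := by field_simp
    · exact absurd ⟨r, hr, q - r, hs, by simp⟩ hn

theorem aux_conv_comm (f g : ℚ → K) : conv f g = conv g f := by
  funext q
  unfold conv
  rw [← (Equiv.subLeft q).tsum_eq]
  refine tsum_congr fun r => ?_
  simp [mul_comm]

theorem aux_conv_shift (f g : ℚ → K) (d : ℚ) :
    conv (fun q => f (q - d)) (fun q => g (q + d)) = conv f g := by
  funext q
  unfold conv
  rw [← (Equiv.addRight d).tsum_eq]
  refine tsum_congr fun r => ?_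
  simp only [Equiv.coe_addRight, add_sub_cancel_right]
  congr 2
  ring

theorem aux_gap {u : ℚ → K} (hu : Tendsto u cofinite (nhds 0))
    (hdom : ∀ q : ℚ, q ≠ 0 → ‖u q‖ < ‖u 0‖) :
    ∃ c : ℝ, 0 ≤ c ∧ c < ‖u 0‖ ∧ ∀ q, q ≠ 0 → ‖u q‖ ≤ c := by
  have h0 : 0 < ‖u 0‖ := (norm_nonneg _).trans_lt (hdom 1 one_ne_zero)
  have h1 := (Metric.tendsto_nhds.1 hu) (‖u 0‖ / 2) (by positivity)
  rw [eventually_cofinite] at h1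
  have hfin : ({q | ¬ dist (u q) 0 < ‖u 0‖ / 2} \ {0}).Finite := h1.sdiff
  rcases Set.eq_empty_or_nonempty ({q | ¬ dist (u q) 0 < ‖u 0‖ / 2} \ {0}) with he | hne
  · refine ⟨‖u 0‖ / 2, by positivity, by linarith, fun q hq => ?_⟩
    by_contra hlt
    have : q ∈ ({q | ¬ dist (u q) 0 < ‖u 0‖ / 2} \ {0}) :=
      ⟨by simp only [dist_zero_right, Set.mem_ofPred_eq]; linarith, hq⟩
    rw [he] at this
    exact this
  · obtain ⟨m, hm, hmax⟩ := Set.exists_max_image _ (fun q => ‖u q‖) hfin hne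
    refine ⟨max (‖u 0‖ / 2) ‖u m‖, by positivity, max_lt (by linarith) (hdom m hm.2),
      fun q hq => ?_⟩
    by_cases hlt : dist (u q) 0 < ‖u 0‖ / 2
    · rw [dist_zero_right] at hlt
      exact hlt.le.trans (le_max_left _ _)
    · exact (hmax q ⟨hlt, hq⟩).trans (le_max_right _ _)

theorem aux_one_tendsto : Tendsto (oneF : ℚ → K) cofinite (nhds 0) := by
  apply tendsto_const_nhds.congr'
  rw [EventuallyEq, eventually_cofinite]
  refine (Set.finite_singleton (0 : ℚ)).subset fun q hq => ?_
  by_contra h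
  exact hq (by simp only [oneF]; rw [if_neg (show ¬ q = 0 from h)])

theorem aux_inverse {u : ℚ → K} (hu : Tendsto u cofinite (nhds 0))
    (hdom : ∀ q : ℚ, q ≠ 0 → ‖u q‖ < ‖u 0‖) :
    ∃ g : ℚ → K, Tendsto g cofinite (nhds 0) ∧ conv u g = oneF := by
  have h0 : 0 < ‖u 0‖ := (norm_nonneg _).trans_lt (hdom 1 one_ne_zero)
  have h0' : u 0 ≠ 0 := norm_pos_iff.1 h0
  obtain ⟨c, hc0, hc, hcb⟩ := aux_gap hu hdom
  let w : ℚ → K := fun q => u q - u 0 * oneF q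
  have hw : Tendsto w cofinite (nhds 0) := by
    simpa using hu.sub (aux_one_tendsto.const_mul (u 0))
  have hwb : ∀ q, ‖w q‖ ≤ c := by
    intro q
    by_cases hq : q = 0
    · simp [w, hq, oneF, hc0]
    · simpa [w, oneF, hq] using hcb q hq
  letI : TopologicalSpace ℚ := ⊥
  haveI : DiscreteTopology ℚ := ⟨rfl⟩
  obtain ⟨g, hg, hfix⟩ := aux_fixed (X := ℚ) (K := K)
    (fun g q => (u 0)⁻¹ * (oneF q - conv w g q))
    (fun f hf => by
      simpa using (aux_one_tendsto.sub (aux_conv_tendsto hw hf)).const_mul (u 0)⁻¹)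
    (‖u 0‖⁻¹ * c) (by positivity) (by rw [inv_mul_lt_one₀ h0]; exact hc)
    (fun f g hf hg C hC hfg q => by
      have e : conv w g q - conv w f q = ∑' r, w r * (g (q - r) - f (q - r)) := by
        unfold conv
        rw [← (aux_summable hw hg q).tsum_sub (aux_summable hw hf q)]
        exact tsum_congr fun r => by ring
      rw [← mul_sub, sub_sub_sub_cancel_left, e, norm_mul, norm_inv, mul_assoc]
      refine mul_le_mul_of_nonneg_left (aux_tsum_le (by positivity) fun r => ?_) (by positivity)
      rw [norm_mul, norm_sub_rev (g _)]
      exact mul_le_mul (hwb _) (hfg _) (norm_nonneg _) hc0)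
  refine ⟨g, hg, funext fun q => ?_⟩
  have h1 : conv u g q = conv w g q + u 0 * g q := by
    have e : ∀ r, u r * g (q - r) = w r * g (q - r) + (u 0 * oneF r) * g (q - r) := by
      intro r; simp only [w]; ring
    have hs : HasSum (fun r => (u 0 * oneF r) * g (q - r)) (u 0 * g q) := by
      have := hasSum_single (f := fun r => (u 0 * oneF r) * g (q - r)) 0
        (fun r hr => by simp [oneF, hr])
      simpa [oneF] using this
    unfold conv
    rw [tsum_congr e, (aux_summable hw hg q).tsum_add hs.summable, hs.tsum_eq]
  have h2 := congrFun hfix q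
  rw [h1, ← h2, mul_inv_cancel_left₀ h0']
  ring

theorem aux_Zp_sub {p : ℕ} (hp : p.Prime) {x y : ℚ} (hx : x ∈ Zpset p) (hy : y ∈ Zpset p) :
    x - y ∈ Zpset p := by
  obtain ⟨a, b, rfl⟩ := hx
  obtain ⟨a', b', rfl⟩ := hy
  have : (p : ℚ) ≠ 0 := by exact_mod_cast hp.ne_zero
  refine ⟨a * p ^ b' - a' * p ^ b, b + b', ?_⟩
  push_cast
  field_simp
  ring

/-- if the constant coefficient of `u ∈ K⟨υ^{±1/p^∞}⟩` strictly dominates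
all other coefficients, then for all `n ∈ ℤ` and `b ∈ ℕ` the element `υ^{n/p^b}·u`
(the shift of `u`, whose coefficient at `q` is `u (q − n/p^b)`) is a unit of
`K⟨υ^{±1/p^∞}⟩`. -/
theorem shift_of_dominated_isUnit (p : ℕ) (hp : p.Prime)
    (u : ℚ → K) (hu : MemAlg (Zpset p) u)
    (hdom : ∀ q : ℚ, q ≠ 0 → ‖u q‖ < ‖u 0‖)
    (n : ℤ) (b : ℕ) :
    IsUnitIn (Zpset p) (fun q => u (q - (n : ℚ) / (p : ℚ) ^ b)) := by
  have hd : (n : ℚ) / (p : ℚ) ^ b ∈ Zpset p := ⟨n, b, rfl⟩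
  generalize (n : ℚ) / (p : ℚ) ^ b = d at hd
  have hz : (0 : ℚ) ∈ Zpset p := ⟨0, 0, by simp⟩
  have hnd : -d ∈ Zpset p := by simpa using aux_Zp_sub hp hz hd
  obtain ⟨g₀, hg₀, hug₀⟩ := aux_inverse hu.2 hdom
  classical
  let g : ℚ → K := fun q => if q ∈ Zpset p then g₀ q else 0
  have hg : Tendsto g cofinite (nhds 0) := by
    refine squeeze_zero_norm (fun q => ?_) (tendsto_zero_iff_norm_tendsto_zero.1 hg₀)
    by_cases hq : q ∈ Zpset p <;> simp [g, hq]
  have hug : conv u g = oneF := by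
    funext q
    by_cases hq : q ∈ Zpset p
    · rw [← hug₀]
      refine tsum_congr fun r => ?_
      by_cases hr : r ∈ Zpset p
      · simp [g, aux_Zp_sub hp hq hr]
      · simp [hu.1 r hr]
    · have hq0 : q ≠ 0 := fun h => hq (h ▸ hz)
      have e : ∀ r, u r * g (q - r) = 0 := by
        intro r
        by_cases hr : r ∈ Zpset p
        · have : q - r ∉ Zpset p := fun h => hq (by
            have h2 := aux_Zp_sub hp h (aux_Zp_sub hp hz hr)
            simpa using h2)
          simp [g, this]
        · simp [hu.1 r hr]
      simp [conv, e, oneF, hq0]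
  have key := (aux_conv_shift u g d).trans hug
  refine ⟨⟨fun q hq => hu.1 _ fun h => hq ?_, ?_⟩, fun q => g (q + d), ⟨fun q hq => ?_, ?_⟩,
    key, (aux_conv_comm _ _).trans key⟩
  · simpa using aux_Zp_sub hp h hnd
  · exact hu.2.comp (sub_left_injective).tendsto_cofinite
  · have : q + d ∉ Zpset p := fun h => hq (by simpa using aux_Zp_sub hp h hd)
    simp [g, this]
  · exact hg.comp (add_left_injective d).tendsto_cofinite
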